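/- arXiv:1308.6348 — 5 statements merged into one kernel-verified Lean document; each statement's English description precedes it below -/
import Mathlib

section
/- Let R be an incline and x an element of R. Then x is regular if and only if x is multiplicatively idempotent, i.e., there exists z in R with x*z*x = x if and only if x*x = x. -/
/-- An incline: a nonempty set with `+` and `*` such that `(R,+)` is a commutative
semigroup, `(R,*)` is a semigroup, `*` distributes over `+` from both sides,
addition is idempotent, and `x + x*y = x`, `x + y*x = x` for all `x y`.
(Nonemptiness is assumed via `Nonempty R` where needed.) -/
class Incline (R : Type*) extends Add R, Mul R where
  add_comm : ∀ x y : R, x + y = y + x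
  add_assoc : ∀ x y z : R, x + y + z = x + (y + z)
  mul_assoc : ∀ x y z : R, x * y * z = x * (y * z)
  left_distrib : ∀ x y z : R, x * (y + z) = x * y + x * z
  right_distrib : ∀ x y z : R, (x + y) * z = x * z + y * z
  add_idem : ∀ x : R, x + x = x
  add_absorb_mul_left : ∀ x y : R, x + x * y = x
  add_absorb_mul_right : ∀ x y : R, x + y * x = x

/-- An element `a` of an incline is regular if `a * z * a = a` for some `z`. -/
def Incline.IsRegular {R : Type*} [Incline R] (a : R) : Prop :=
  ∃ z : R, a * z * a = a

theorem incline_regular_iff_mul_idem {R : Type*} [Incline R] (x : R) :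
    Incline.IsRegular x ↔ x * x = x := by
  constructor
  · rintro ⟨z, hz⟩
    calc x * x = (x + x * z) * x := by rw [Incline.add_absorb_mul_left]
      _ = x * x + x := by rw [Incline.right_distrib, hz]
      _ = x := by rw [Incline.add_comm, Incline.add_absorb_mul_left]
  · intro h
    exact ⟨x, by rw [h, h]⟩
end

section
/- An incline R is regular (every element is regular) if and only if it is multiplicatively idempotent (every element x satisfies x*x = x). -/
/-- A regular element of an incline is multiplicatively idempotent. -/
theorem Incline.IsRegular.mul_self {R : Type*} [Incline R] {a : R} (h : Incline.IsRegular a) :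
    a * a = a := by
  obtain ⟨z, hz⟩ := h
  calc a * a = (a + a * z) * a := by rw [Incline.add_absorb_mul_left]
    _ = a * a + a := by rw [Incline.right_distrib, hz]
    _ = a := by rw [Incline.add_comm, Incline.add_absorb_mul_left]

theorem incline_regular_iff_mul_idem_all {R : Type*} [Incline R] [Nonempty R] :
    (∀ x : R, Incline.IsRegular x) ↔ (∀ x : R, x * x = x) := by
  exact ⟨fun h x => (h x).mul_self, fun h x => ⟨x, by rw [h, h]⟩⟩
end

section
/- Let R be an incline and x a regular element of R. For any y in R, the product x*y is regular if and only if y*x*y = x*y. -/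
namespace Incline

variable {R : Type*} [Incline R]

theorem eq_of_left_multiples {a b u v : R} (hab : u * b = a) (hba : v * a = b) : a = b := by
  have h₁ : b + a = b := hab ▸ add_absorb_mul_right b u
  have h₂ : a + b = a := hba ▸ add_absorb_mul_right a v
  rw [← h₂, add_comm, h₁]

theorem eq_of_right_multiples {a b u v : R} (hab : b * u = a) (hba : a * v = b) : a = b := by
  have h₁ : b + a = b := hab ▸ add_absorb_mul_left b u
  have h₂ : a + b = a := hba ▸ add_absorb_mul_left a v
  rw [← h₂, add_comm, h₁]

theorem isRegular_iff_mul_self {a : R} : IsRegular a ↔ a * a = a := by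
  constructor
  · rintro ⟨z, hz⟩
    have h : a = a * z := eq_of_right_multiples hz rfl
    rwa [← h] at hz
  · intro h
    exact ⟨a, by rw [h, h]⟩

end Incline

theorem incline_mul_regular_iff_left {R : Type*} [Incline R] (x : R)
    (hx : Incline.IsRegular x) (y : R) :
    Incline.IsRegular (x * y) ↔ y * x * y = x * y := by
  rw [Incline.isRegular_iff_mul_self] at hx ⊢
  constructor
  · intro h
    refine Incline.eq_of_left_multiples (u := y) (v := x) (Incline.mul_assoc y x y).symm ?_
    rw [← Incline.mul_assoc, ← Incline.mul_assoc, Incline.mul_assoc (x * y), h]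
  · intro h
    rw [Incline.mul_assoc x y, ← Incline.mul_assoc y, h, ← Incline.mul_assoc, hx]
end

section
/- Let R be an incline and x a regular element of R. For any y in R, the product y*x is regular if and only if y*x*y = y*x. -/
namespace Incline

variable {R : Type*} [Incline R]

theorem eq_of_mul_mul_eq {a b c : R} (h : a * b * c = a) : a * b = a := by
  have h₁ := add_absorb_mul_left (a * b) c
  rw [h, add_comm, add_absorb_mul_left] at h₁
  exact h₁.symm

theorem IsRegular.mul_self_s4 {a : R} (h : IsRegular a) : a * a = a := by
  obtain ⟨z, hz⟩ := h
  rwa [eq_of_mul_mul_eq hz] at hz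

theorem isRegular_of_mul_self {a : R} (h : a * a = a) : IsRegular a :=
  ⟨a, by rw [h, h]⟩

end Incline

theorem incline_mul_regular_iff_right {R : Type*} [Incline R] (x : R)
    (hx : Incline.IsRegular x) (y : R) :
    Incline.IsRegular (y * x) ↔ y * x * y = y * x := by
  constructor
  · intro h
    have hyx := h.mul_self_s4
    rw [← Incline.mul_assoc] at hyx
    exact Incline.eq_of_mul_mul_eq hyx
  · intro h
    apply Incline.isRegular_of_mul_self
    rw [← Incline.mul_assoc, h, Incline.mul_assoc, hx.mul_self_s4]
end

section
/- Let R be a commutative incline whose set I(R) of multiplicatively idempotent elements is nonempty. Then I(R), partially ordered by the incline order, is a distributive lattice in which the join of x and y is x + y and the meet of x and y is x*y. -/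
namespace Incline

variable {R : Type*} [Incline R]

theorem mul_self_add (hcomm : ∀ a b : R, a * b = b * a) {a b : R}
    (ha : a * a = a) (hb : b * b = b) : (a + b) * (a + b) = a + b := by
  rw [left_distrib, right_distrib, right_distrib, ha, hb, hcomm b a, add_absorb_mul_left,
    Incline.add_comm (a * b) b, add_absorb_mul_right]

theorem mul_self_mul (hcomm : ∀ a b : R, a * b = b * a) {a b : R}
    (ha : a * a = a) (hb : b * b = b) : (a * b) * (a * b) = a * b := by
  rw [Incline.mul_assoc, ← Incline.mul_assoc b, hcomm b a, Incline.mul_assoc a b b, hb,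
    ← Incline.mul_assoc, ha]

theorem add_mul_add_of_mul_self {a : R} (ha : a * a = a) (b c : R) :
    (a + b) * (a + c) = a + b * c := by
  rw [left_distrib, right_distrib, right_distrib, ha, add_absorb_mul_right,
    ← Incline.add_assoc, add_absorb_mul_left]

/-- The distributive lattice of multiplicatively idempotent elements of a commutative incline. -/
abbrev idemDistribLattice (hcomm : ∀ a b : R, a * b = b * a) :
    DistribLattice {a : R // a * a = a} where
  le x y := (x : R) + y = y
  le_refl x := add_idem (x : R)
  le_trans x y z hxy hyz := by
    rw [← hyz, ← Incline.add_assoc, hxy]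
  le_antisymm x y hxy hyx := Subtype.ext <| by
    rw [← hyx, Incline.add_comm, hxy]
  sup x y := ⟨x + y, mul_self_add hcomm x.2 y.2⟩
  le_sup_left x y := by
    change (x : R) + (x + y) = x + y
    rw [← Incline.add_assoc, add_idem]
  le_sup_right x y := by
    change (y : R) + (x + y) = x + y
    rw [Incline.add_comm (x : R), ← Incline.add_assoc, add_idem]
  sup_le x y z hxz hyz := by
    change (x : R) + y + z = z
    rw [Incline.add_assoc, hyz, hxz]
  inf x y := ⟨x * y, mul_self_mul hcomm x.2 y.2⟩
  inf_le_left x y := by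
    change (x : R) * y + x = x
    rw [Incline.add_comm, add_absorb_mul_left]
  inf_le_right x y := by
    change (x : R) * y + y = y
    rw [Incline.add_comm, add_absorb_mul_right]
  le_inf x y z hxy hxz := by
    change (x : R) + y * z = y * z
    rw [← add_mul_add_of_mul_self x.2, hxy, hxz]
  le_sup_inf x y z := by
    change ((x : R) + y) * (x + z) + (x + y * z) = x + y * z
    rw [add_mul_add_of_mul_self x.2, add_idem]

end Incline

theorem incline_idem_set_distribLattice {R : Type*} [Incline R]
    (hcomm : ∀ a b : R, a * b = b * a)
    (hne : Nonempty {a : R // a * a = a}) :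
    ∃ L : DistribLattice {a : R // a * a = a},
      (∀ x y : {a : R // a * a = a}, L.le x y ↔ (x : R) + (y : R) = (y : R)) ∧
      (∀ x y : {a : R // a * a = a}, ((L.sup x y : {a : R // a * a = a}) : R) = (x : R) + (y : R)) ∧
      (∀ x y : {a : R // a * a = a}, ((L.inf x y : {a : R // a * a = a}) : R) = (x : R) * (y : R)) := by
  exact ⟨Incline.idemDistribLattice hcomm, fun _ _ => Iff.rfl, fun _ _ => rfl,
    fun _ _ => rfl⟩
end
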